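/- For every real ε > 0 and every positive integer k there exists a real β = β(ε, k) such that for every positive integer m there is a robust algorithm for cardinality constrained scheduling on m machines with cardinality bound k whose migration factor is at most β and which is (1+ε)-competitive. -/

import Mathlib

open Finset

/-- The load of machine `i` under schedule `σ` for job sizes `p`. -/
noncomputable def machineLoad {n m : ℕ} (p : Fin n → ℝ) (σ : Fin n → Fin m) (i : Fin m) : ℝ :=
  ∑ j ∈ Finset.univ.filter (fun j => σ j = i), p j

/-- The makespan of a schedule: the maximum machine load. -/
noncomputable def makespan {n m : ℕ} (p : Fin n → ℝ) (σ : Fin n → Fin m) : ℝ :=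
  sSup (Set.range (machineLoad p σ))

/-- A schedule is feasible for cardinality bound `k` if every machine gets at most `k` jobs. -/
def Feasible {n m : ℕ} (k : ℕ) (σ : Fin n → Fin m) : Prop :=
  ∀ i : Fin m, (Finset.univ.filter (fun j => σ j = i)).card ≤ k

/-- The optimal (minimum) makespan over all feasible schedules on `m` machines with
cardinality bound `k`. -/
noncomputable def OPT (m k : ℕ) {n : ℕ} (p : Fin n → ℝ) : ℝ :=
  sInf ((fun σ : Fin n → Fin m => makespan p σ) '' {σ | Feasible k σ})

/-- The schedule induced by a deterministic online algorithm `A` on input sequence `p`: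
job `j` is assigned to the machine `A (p 1, …, p j)`. -/
def onlineSchedule {m : ℕ} (A : List ℝ → Fin m) {n : ℕ} (p : Fin n → ℝ) : Fin n → Fin m :=
  fun j => A ((List.ofFn p).take (j.1 + 1))

/-- An online algorithm is `α`-competitive if on every input sequence of at most `m*k`
nonnegative jobs the induced schedule is feasible and its makespan is at most `α * OPT`. -/
def Competitive (m k : ℕ) (A : List ℝ → Fin m) (α : ℝ) : Prop :=
  ∀ n : ℕ, n ≤ m * k → ∀ p : Fin n → ℝ, (∀ j, 0 ≤ p j) →
    Feasible k (onlineSchedule A p) ∧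
      makespan p (onlineSchedule A p) ≤ α * OPT m k p

/-- A (deterministic) algorithm processing jobs one by one: after the `t`-th job it outputs a
schedule of jobs `1, …, t` determined by the sizes of the first `t` jobs. -/
def RobustAlg (m : ℕ) := ∀ t : ℕ, (Fin t → ℝ) → Fin t → Fin m

/-- The first `t` jobs of an infinite input sequence. -/
def prefixSeq (p : ℕ → ℝ) (t : ℕ) : Fin t → ℝ := fun j => p j.1

/-- `R` is a robust algorithm for `m` machines and cardinality bound `k` with migration
factor `β`: on every nonnegative input sequence, (i) each schedule `σ_t` with `t ≤ m*k` is
feasible, and (ii) the total size of the jobs `j < t` with `σ_t j ≠ σ_{t-1} j` is at most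
`β` times the size of the `t`-th job. -/
def IsRobust (m k : ℕ) (β : ℝ) (R : RobustAlg m) : Prop :=
  ∀ p : ℕ → ℝ, (∀ j, 0 ≤ p j) →
    (∀ t : ℕ, t ≤ m * k → Feasible k (R t (prefixSeq p t))) ∧
    (∀ s : ℕ, s + 1 ≤ m * k →
      (∑ j ∈ Finset.univ.filter
          (fun j : Fin s =>
            R (s + 1) (prefixSeq p (s + 1)) j.castSucc ≠ R s (prefixSeq p s) j),
        p j.1) ≤ β * p s)

/-- A robust algorithm is `α`-competitive if on every nonnegative input sequence and every
`t ≤ m*k`, the makespan of its schedule of the first `t` jobs is at most `α` times the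
optimal makespan for these jobs. -/
def RobustCompetitive (m k : ℕ) (R : RobustAlg m) (α : ℝ) : Prop :=
  ∀ p : ℕ → ℝ, (∀ j, 0 ≤ p j) → ∀ t : ℕ, t ≤ m * k →
    makespan (prefixSeq p t) (R t (prefixSeq p t)) ≤ α * OPT m k (prefixSeq p t)


/-- Dickson's lemma, quantitatively: below each point of `S` there is a point of `S` whose
coordinate sum is bounded in terms of `S` only. -/
lemma exists_sum_le_below {ι : Type*} [Fintype ι] (S : Set (ι → ℕ)) :
    ∃ K : ℕ, ∀ z ∈ S, ∃ w ∈ S, w ≤ z ∧ ∑ i, w i ≤ K := by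
  have hfin : {w | Minimal (· ∈ S) w}.Finite :=
    WellQuasiOrderedLE.finite_of_isAntichain (setOfPred_minimal_antichain (· ∈ S))
  obtain ⟨K, hK⟩ := (hfin.image fun w => ∑ i, w i).bddAbove
  refine ⟨K, fun z hz => ?_⟩
  obtain ⟨w, hwz, hw⟩ := exists_minimal_le_of_wellFoundedLT (· ∈ S) z hz
  exact ⟨w, hw.prop, hwz, hK ⟨w, hw, rfl⟩⟩

/-- A finite family contains a subfamily with any prescribed smaller multiplicities. -/
lemma exists_finset_card_fiber {ι γ : Type*} [Fintype ι] [DecidableEq ι] [DecidableEq γ]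
    (f : ι → γ) (u : γ → ℕ) (hu : ∀ g, u g ≤ #{i | f i = g}) :
    ∃ U : Finset ι, ∀ g, #{i ∈ U | f i = g} = u g := by
  choose s hs hcard using fun g => Finset.exists_subset_card_eq (hu g)
  refine ⟨Finset.univ.filter fun i => i ∈ s (f i), fun g => ?_⟩
  rw [← hcard g]
  congr 1
  ext i
  simp only [Finset.mem_filter, Finset.mem_univ, true_and]
  constructor
  · rintro ⟨h, rfl⟩
    exact h
  · intro h
    have hi := hs g h
    simp only [Finset.mem_filter, Finset.mem_univ, true_and] at hi
    subst hi
    exact ⟨h, rfl⟩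

lemma sum_comp_eq_sum_card {ι γ : Type*} [Fintype γ] [DecidableEq γ]
    (U : Finset ι) (f : ι → γ) (h : γ → ℕ) :
    ∑ i ∈ U, h (f i) = ∑ g, #{i ∈ U | f i = g} * h g := by
  rw [← Finset.sum_fiberwise U f]
  refine Finset.sum_congr rfl fun g _ => ?_
  rw [Finset.sum_congr rfl (g := fun _ => h g), Finset.sum_const, smul_eq_mul]
  intro i hi
  rw [(Finset.mem_filter.1 hi).2]

/-- Sensitivity of configuration programs: if the columns of `b` sum up to those of `a` plus one
unit vector, then already boundedly many rows of `a` and equally many rows of `b` do so. -/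
lemma exists_bounded_exchange (d k : ℕ) :
    ∃ K : ℕ, ∀ (m : ℕ) (a b : Fin m → Fin d → ℕ), (∀ i c, a i c ≤ k) → (∀ i c, b i c ≤ k) →
      ∀ e : Fin d, (∀ c, ∑ i, b i c = ∑ i, a i c + if e = c then 1 else 0) →
      ∃ W U : Finset (Fin m), #U = #W ∧ #W ≤ K ∧
        ∀ c, ∑ i ∈ U, b i c = ∑ i ∈ W, a i c + if e = c then 1 else 0 := by
  let Γ := Fin d → Fin (k + 1)
  let S : Fin d → Set (Γ ⊕ Γ → ℕ) := fun e =>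
    {w | ∑ g, w (Sum.inl g) = ∑ g, w (Sum.inr g) ∧
      ∀ c, ∑ g, w (Sum.inl g) * (g c : ℕ) =
        ∑ g, w (Sum.inr g) * (g c : ℕ) + if e = c then 1 else 0}
  choose K hK using fun e => exists_sum_le_below (S e)
  refine ⟨Finset.univ.sup K, fun m a b ha hb e hab => ?_⟩
  let f : Fin m → Γ := fun i c => ⟨a i c, Nat.lt_succ_of_le (ha i c)⟩
  let g : Fin m → Γ := fun i c => ⟨b i c, Nat.lt_succ_of_le (hb i c)⟩
  have hf : ∀ (V : Finset (Fin m)) c, ∑ i ∈ V, a i c = ∑ γ, #{i ∈ V | f i = γ} * (γ c : ℕ) :=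
    fun V c => sum_comp_eq_sum_card V f fun γ => (γ c : ℕ)
  have hg : ∀ (V : Finset (Fin m)) c, ∑ i ∈ V, b i c = ∑ γ, #{i ∈ V | g i = γ} * (γ c : ℕ) :=
    fun V c => sum_comp_eq_sum_card V g fun γ => (γ c : ℕ)
  have hcf : ∀ V : Finset (Fin m), ∑ γ, #{i ∈ V | f i = γ} = #V := fun V =>
    (Finset.card_eq_sum_card_fiberwise fun _ _ => Finset.mem_coe.2 (Finset.mem_univ _)).symm
  have hcg : ∀ V : Finset (Fin m), ∑ γ, #{i ∈ V | g i = γ} = #V := fun V =>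
    (Finset.card_eq_sum_card_fiberwise fun _ _ => Finset.mem_coe.2 (Finset.mem_univ _)).symm
  let z : Γ ⊕ Γ → ℕ := Sum.elim (fun γ => #{i | g i = γ}) fun γ => #{i | f i = γ}
  have hz : z ∈ S e := by
    refine ⟨by simp only [z, Sum.elim_inl, Sum.elim_inr, hcf, hcg], fun c => ?_⟩
    simpa only [z, Sum.elim_inl, Sum.elim_inr, ← hf, ← hg] using hab c
  obtain ⟨w, ⟨hw1, hw2⟩, hwz, hwK⟩ := hK e z hz
  obtain ⟨U, hU⟩ := exists_finset_card_fiber g (fun γ => w (Sum.inl γ)) fun γ => hwz (Sum.inl γ)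
  obtain ⟨W, hW⟩ := exists_finset_card_fiber f (fun γ => w (Sum.inr γ)) fun γ => hwz (Sum.inr γ)
  refine ⟨W, U, ?_, ?_, fun c => ?_⟩
  · rw [← hcg, ← hcf]
    simpa only [hU, hW] using hw1
  · rw [← hcf]
    simp only [hW]
    rw [Fintype.sum_sum_type] at hwK
    exact (le_trans (Nat.le_add_left _ _) hwK).trans (Finset.le_sup (Finset.mem_univ e))
  · rw [hg, hf]
    simpa only [hU, hW] using hw2 c

/-- A partial feasible assignment extends to a feasible schedule. -/
lemma exists_feasible_extension {N m k : ℕ} (hN : N ≤ m * k) (A : Finset (Fin N))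
    (σ : Fin N → Fin m) (hσ : ∀ i, #{j ∈ A | σ j = i} ≤ k) :
    ∃ σ' : Fin N → Fin m, Feasible k σ' ∧ ∀ j ∈ A, σ' j = σ j := by
  induction hr : #Aᶜ generalizing A σ with
  | zero =>
    rw [Finset.card_eq_zero, Finset.compl_eq_empty_iff] at hr
    subst hr
    exact ⟨σ, hσ, fun _ _ => rfl⟩
  | succ r ih =>
    obtain ⟨j₀, hj₀⟩ : Aᶜ.Nonempty := Finset.card_pos.1 (by omega)
    rw [Finset.mem_compl] at hj₀
    obtain ⟨i₀, hi₀⟩ : ∃ i, #{j ∈ A | σ j = i} < k := by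
      by_contra! hcon
      have hcard : #A = ∑ i, #{j ∈ A | σ j = i} :=
        Finset.card_eq_sum_card_fiberwise fun _ _ => Finset.mem_coe.2 (Finset.mem_univ _)
      have hle : ∑ _i : Fin m, k ≤ #A := hcard ▸ Finset.sum_le_sum fun i _ => hcon i
      have hadd := Finset.card_add_card_compl A
      simp only [Finset.sum_const, Finset.card_univ, Fintype.card_fin, smul_eq_mul] at hle hadd
      omega
    have hagree : ∀ j ∈ A, Function.update σ j₀ i₀ j = σ j := fun j hj =>
      Function.update_of_ne (ne_of_mem_of_not_mem hj hj₀) _ _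
    obtain ⟨σ', hσ', hA⟩ := ih (insert j₀ A) (Function.update σ j₀ i₀) (fun i => by
      have hfil : {j ∈ A | Function.update σ j₀ i₀ j = i} = {j ∈ A | σ j = i} :=
        Finset.filter_congr fun j hj => by rw [hagree j hj]
      rw [Finset.filter_insert, hfil, Function.update_self]
      split_ifs with h
      · subst h
        exact (Finset.card_insert_le _ _).trans hi₀
      · exact hσ i) (by
      rw [Finset.compl_insert, Finset.card_erase_of_mem (Finset.mem_compl.2 hj₀), hr]
      rfl)
    exact ⟨σ', hσ', fun j hj => (hA j (Finset.mem_insert_of_mem hj)).trans (hagree j hj)⟩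

/-- Two finite sets with the same number of elements of each color are related by a
color-preserving injection. -/
lemma exists_injOn_of_card_fiber_eq {α β γ : Type*} [Nonempty β] [DecidableEq γ]
    (A : Finset α) (B : Finset β) (f : α → γ) (g : β → γ)
    (h : ∀ c, #{a ∈ A | f a = c} = #{b ∈ B | g b = c}) :
    ∃ Φ : α → β, Set.InjOn Φ A ∧ ∀ a ∈ A, Φ a ∈ B ∧ g (Φ a) = f a := by
  classical
  have key : ∀ c, ∃ φ : α → β, Set.InjOn φ {a ∈ A | f a = c} ∧
      ∀ a ∈ A, f a = c → φ a ∈ B ∧ g (φ a) = c := by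
    intro c
    let e := Finset.equivOfCardEq (h c)
    refine ⟨fun a => if ha : a ∈ A.filter (f · = c) then e ⟨a, ha⟩ else Classical.arbitrary β,
      ?_, ?_⟩
    · intro a ha b hb hab
      have ha' : a ∈ A.filter (f · = c) := Finset.mem_filter.2 ha
      have hb' : b ∈ A.filter (f · = c) := Finset.mem_filter.2 hb
      simp only [dif_pos ha', dif_pos hb'] at hab
      simpa using e.injective (Subtype.ext hab)
    · intro a ha hac
      have ha' : a ∈ A.filter (f · = c) := Finset.mem_filter.2 ⟨ha, hac⟩
      simp only [dif_pos ha']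
      exact Finset.mem_filter.1 (e ⟨a, ha'⟩).2
  choose φ hinj hφ using key
  refine ⟨fun a => φ (f a) a, ?_, fun a ha => hφ (f a) a ha rfl⟩
  intro a ha b hb hab
  have hfab : f a = f b := by
    rw [← (hφ (f a) a ha rfl).2, ← (hφ (f b) b hb rfl).2]
    exact congrArg g hab
  exact hinj (f b) ⟨ha, hfab⟩ ⟨hb, rfl⟩ (by simpa only [hfab] using hab)

lemma card_filter_fin_succ {n : ℕ} (P : Fin (n + 1) → Prop) [DecidablePred P] :
    #{j | P j} = #{j : Fin n | P j.castSucc} + if P (Fin.last n) then 1 else 0 := by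
  simp only [Finset.card_filter, Fin.sum_univ_castSucc]

/-- When a job with a type arrives, a schedule can be turned into a schedule of all jobs by
reassigning boundedly many machines only, in such a way that each machine carries no more typed
jobs than some machine in the old schedule or in a given reference schedule `τ`. Jobs without a
type only matter for the cardinality bound. -/
lemma exists_rearrangement (d k : ℕ) :
    ∃ K : ℕ, ∀ m n : ℕ, n + 1 ≤ m * k → ∀ (ty : Fin (n + 1) → Option (Fin d))
      (σ : Fin n → Fin m) (τ : Fin (n + 1) → Fin m), Feasible k σ → Feasible k τ →
      ty (Fin.last n) ≠ none →
      ∃ (W : Finset (Fin m)) (σ' : Fin (n + 1) → Fin m), #W ≤ K ∧ Feasible k σ' ∧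
        (∀ j, σ j ∉ W → σ' j.castSucc = σ j) ∧
        ∀ f : Option (Fin d) → ℝ, f none = 0 → (∀ x, 0 ≤ f x) → ∀ i,
          (∑ j with σ' j = i, f (ty j) ≤ ∑ j with σ j = i, f (ty j.castSucc)) ∨
          ∃ i', ∑ j with σ' j = i, f (ty j) ≤ ∑ j with τ j = i', f (ty j) := by
  classical
  obtain ⟨K, hK⟩ := exists_bounded_exchange d k
  refine ⟨K, fun m n hn ty σ τ hσ hτ hlast => ?_⟩
  obtain ⟨e, he⟩ := Option.ne_none_iff_exists'.1 hlast
  have hm : Nonempty (Fin m) := ⟨τ (Fin.last n)⟩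
  let a : Fin m → Fin d → ℕ := fun i c => #{j : Fin n | σ j = i ∧ ty j.castSucc = some c}
  let b : Fin m → Fin d → ℕ := fun i c => #{j | τ j = i ∧ ty j = some c}
  have ha : ∀ (V : Finset (Fin m)) c,
      ∑ i ∈ V, a i c = #{j : Fin n | σ j ∈ V ∧ ty j.castSucc = some c} := by
    intro V c
    rw [Finset.card_eq_sum_card_fiberwise (f := σ) (t := V)
      fun j hj => (Finset.mem_filter.1 hj).2.1]
    refine Finset.sum_congr rfl fun i hi => congrArg Finset.card ?_
    ext j
    simp only [Finset.mem_filter, Finset.mem_univ, true_and]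
    grind
  have hb : ∀ (V : Finset (Fin m)) c,
      ∑ i ∈ V, b i c = #{j | τ j ∈ V ∧ ty j = some c} := by
    intro V c
    rw [Finset.card_eq_sum_card_fiberwise (f := τ) (t := V)
      fun j hj => (Finset.mem_filter.1 hj).2.1]
    refine Finset.sum_congr rfl fun i hi => congrArg Finset.card ?_
    ext j
    simp only [Finset.mem_filter, Finset.mem_univ, true_and]
    grind
  obtain ⟨W, U, hUW, hWK, hex⟩ := hK m a b
    (fun i c => (Finset.card_le_card (Finset.monotone_filter_right _ fun _ _ h => h.1)).trans
      (hσ i))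
    (fun i c => (Finset.card_le_card (Finset.monotone_filter_right _ fun _ _ h => h.1)).trans
      (hτ i)) e (by
      intro c
      rw [ha, hb, card_filter_fin_succ]
      simp [he])
  let J : Finset (Fin (n + 1)) :=
    Finset.univ.filter fun j => ty j ≠ none ∧ ∀ j₀ : Fin n, j = j₀.castSucc → σ j₀ ∈ W
  let T : Finset (Fin (n + 1)) := Finset.univ.filter fun j => ty j ≠ none ∧ τ j ∈ U
  obtain ⟨Φ, hΦinj, hΦ⟩ := exists_injOn_of_card_fiber_eq J T ty ty (by
    intro c
    rcases c with _ | c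
    · rw [Finset.filter_false_of_mem, Finset.filter_false_of_mem]
      · exact fun j hj => (Finset.mem_filter.1 hj).2.1
      · exact fun j hj => (Finset.mem_filter.1 hj).2.1
    · have h1 : {j ∈ T | ty j = some c} =
          Finset.univ.filter fun j => τ j ∈ U ∧ ty j = some c := by
        ext j
        simp only [T, Finset.mem_filter, Finset.mem_univ, true_and]
        grind
      have h2 : {j ∈ J | ty j = some c} = Finset.univ.filter fun j =>
          (∀ j₀ : Fin n, j = j₀.castSucc → σ j₀ ∈ W) ∧ ty j = some c := by
        ext j
        simp only [J, Finset.mem_filter, Finset.mem_univ, true_and]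
        grind
      rw [h1, h2, ← hb, hex, ha, card_filter_fin_succ]
      simp [he, (Fin.castSucc_lt_last _).ne'])
  obtain ⟨Ψ, hΨinj, hΨ⟩ := exists_injOn_of_card_fiber_eq U W (fun _ => ()) (fun _ => ())
    (by simpa using hUW)
  let σ₁ : Fin (n + 1) → Fin m := fun j =>
    if j ∈ J then Ψ (τ (Φ j)) else Fin.lastCases (Classical.arbitrary _) σ j
  let A : Finset (Fin (n + 1)) :=
    Finset.univ.filter fun j => j ∈ J ∨ ∃ j₀ : Fin n, j = j₀.castSucc ∧ σ j₀ ∉ W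
  have hσJ : ∀ j ∈ J, σ₁ j = Ψ (τ (Φ j)) := fun j hj => if_pos hj
  have hτU : ∀ j ∈ J, τ (Φ j) ∈ U := fun j hj => (Finset.mem_filter.1 (hΦ j hj).1).2.2
  have hσJW : ∀ j ∈ J, σ₁ j ∈ W := fun j hj => by
    rw [hσJ j hj]
    exact (hΨ _ (hτU j hj)).1
  have hσW : ∀ j₀, σ j₀ ∉ W → σ₁ j₀.castSucc = σ j₀ := by
    intro j₀ h
    have hJ : j₀.castSucc ∉ J := fun hJ => h ((Finset.mem_filter.1 hJ).2.2 j₀ rfl)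
    simp only [σ₁, if_neg hJ, Fin.lastCases_castSucc]
  have hin : ∀ i ∈ W, ∃ i', ∀ j ∈ A, σ₁ j = i → j ∈ J ∧ τ (Φ j) = i' := by
    intro i hi
    have hJ : ∀ j ∈ A, σ₁ j = i → j ∈ J := by
      intro j hj hji
      rcases (Finset.mem_filter.1 hj).2 with hJ | ⟨j₀, rfl, hj₀⟩
      · exact hJ
      · rw [hσW _ hj₀] at hji
        exact absurd (hji ▸ hi) hj₀
    by_cases hne : ∃ j ∈ A, σ₁ j = i
    · obtain ⟨j, hjA, hji⟩ := hne
      refine ⟨τ (Φ j), fun l hlA hli => ⟨hJ l hlA hli, ?_⟩⟩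
      refine hΨinj (hτU _ (hJ l hlA hli)) (hτU _ (hJ j hjA hji)) ?_
      rw [← hσJ _ (hJ l hlA hli), ← hσJ _ (hJ j hjA hji), hli, hji]
    · push Not at hne
      exact ⟨i, fun j hj h => absurd h (hne j hj)⟩
  have hout : ∀ i ∉ W, ∀ j ∈ A, σ₁ j = i → ∃ j₀ : Fin n, j₀.castSucc = j ∧ σ j₀ = i := by
    intro i hi j hj hji
    rcases (Finset.mem_filter.1 hj).2 with hJ | ⟨j₀, rfl, hj₀⟩
    · exact absurd (hji ▸ hσJW j hJ) hi
    · exact ⟨j₀, rfl, (hσW _ hj₀).symm.trans hji⟩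
  have htyA : ∀ j, ty j ≠ none → j ∈ A := by
    intro j hj
    simp only [A, J, Finset.mem_filter, Finset.mem_univ, true_and]
    by_cases h : ∀ j₀ : Fin n, j = j₀.castSucc → σ j₀ ∈ W
    · exact Or.inl ⟨hj, h⟩
    · push Not at h
      exact Or.inr h
  obtain ⟨σ', hσ', hA⟩ := exists_feasible_extension hn A σ₁ (by
    intro i
    by_cases hi : i ∈ W
    · obtain ⟨i', hi'⟩ := hin i hi
      refine le_trans (Finset.card_le_card_of_injOn Φ ?_ ?_) (hτ i')
      · intro j hj
        have hj' := Finset.mem_filter.1 hj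
        exact Finset.mem_filter.2 ⟨Finset.mem_univ _, (hi' j hj'.1 hj'.2).2⟩
      · refine hΦinj.mono fun j hj => ?_
        have hj' := Finset.mem_filter.1 hj
        exact (hi' j hj'.1 hj'.2).1
    · refine le_trans (Finset.card_le_card ?_) ((Finset.card_map Fin.castSuccEmb).trans_le (hσ i))
      intro j hj
      have hj' := Finset.mem_filter.1 hj
      obtain ⟨j₀, rfl, h⟩ := hout i hi j hj'.1 hj'.2
      exact Finset.mem_map.2 ⟨j₀, Finset.mem_filter.2 ⟨Finset.mem_univ _, h⟩, rfl⟩)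
  refine ⟨W, σ', hWK, hσ', fun j hj => ?_, fun f hf0 hf i => ?_⟩
  · rw [hA _ (Finset.mem_filter.2 ⟨Finset.mem_univ _, Or.inr ⟨j, rfl, hj⟩⟩), hσW j hj]
  have hsum : ∑ j with σ' j = i, f (ty j) = ∑ j ∈ A with σ₁ j = i ∧ ty j ≠ none, f (ty j) := by
    symm
    refine Finset.sum_subset_zero_on_sdiff ?_ ?_ fun _ _ => rfl
    · intro j hj
      have hj' := Finset.mem_filter.1 hj
      exact Finset.mem_filter.2 ⟨Finset.mem_univ _, (hA j hj'.1).trans hj'.2.1⟩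
    · intro j hj
      rw [Finset.mem_sdiff, Finset.mem_filter, Finset.mem_filter] at hj
      have hnone : ty j = none := by
        by_contra h
        exact hj.2 ⟨htyA j h, (hA j (htyA j h)).symm.trans hj.1.2, h⟩
      rw [hnone, hf0]
  rw [hsum]
  by_cases hi : i ∈ W
  · obtain ⟨i', hi'⟩ := hin i hi
    refine Or.inr ⟨i', ?_⟩
    have hJ : ∀ j ∈ A.filter fun j => σ₁ j = i ∧ ty j ≠ none, j ∈ J ∧ τ (Φ j) = i' := by
      intro j hj
      have hj' := Finset.mem_filter.1 hj
      exact hi' j hj'.1 hj'.2.1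
    rw [Finset.sum_congr rfl fun j hj => congrArg f (hΦ j (hJ j hj).1).2.symm,
      ← Finset.sum_image (f := fun j => f (ty j)) fun x hx y hy h =>
        hΦinj (hJ x hx).1 (hJ y hy).1 h]
    refine Finset.sum_le_sum_of_subset_of_nonneg (fun j hj => ?_) fun _ _ _ => hf _
    obtain ⟨l, hl, rfl⟩ := Finset.mem_image.1 hj
    exact Finset.mem_filter.2 ⟨Finset.mem_univ _, (hJ l hl).2⟩
  · left
    refine le_of_le_of_eq ?_ (Finset.sum_map {j | σ j = i} Fin.castSuccEmb fun j => f (ty j))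
    refine Finset.sum_le_sum_of_subset_of_nonneg (fun j hj => ?_) fun _ _ _ => hf _
    have hj' := Finset.mem_filter.1 hj
    obtain ⟨j₀, rfl, h⟩ := hout i hi j hj'.1 hj'.2.1
    exact Finset.mem_map.2 ⟨j₀, Finset.mem_filter.2 ⟨Finset.mem_univ _, h⟩, rfl⟩

section Makespan

variable {m k n : ℕ}

lemma machineLoad_le_makespan (p : Fin n → ℝ) (σ : Fin n → Fin m) (i : Fin m) :
    machineLoad p σ i ≤ makespan p σ :=
  le_csSup (Set.finite_range _).bddAbove ⟨i, rfl⟩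

lemma makespan_le (hm : 0 < m) {p : Fin n → ℝ} {σ : Fin n → Fin m} {B : ℝ}
    (h : ∀ i, machineLoad p σ i ≤ B) : makespan p σ ≤ B := by
  have : Nonempty (Fin m) := ⟨⟨0, hm⟩⟩
  refine csSup_le (Set.range_nonempty _) ?_
  rintro _ ⟨i, rfl⟩
  exact h i

lemma le_machineLoad {p : Fin n → ℝ} (hp : ∀ j, 0 ≤ p j) (σ : Fin n → Fin m) (j : Fin n) :
    p j ≤ machineLoad p σ (σ j) :=
  Finset.single_le_sum (f := p) (fun l _ => hp l) (Finset.mem_filter.2 ⟨Finset.mem_univ j, rfl⟩)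

lemma OPT_le_makespan (p : Fin n → ℝ) {σ : Fin n → Fin m} (hσ : Feasible k σ) :
    OPT m k p ≤ makespan p σ :=
  csInf_le (Set.toFinite _).bddBelow ⟨σ, hσ, rfl⟩

lemma exists_makespan_eq_OPT (hm : 0 < m) (hn : n ≤ m * k) (p : Fin n → ℝ) :
    ∃ τ : Fin n → Fin m, Feasible k τ ∧ makespan p τ = OPT m k p := by
  obtain ⟨σ, hσ, -⟩ := exists_feasible_extension hn ∅ (fun _ => ⟨0, hm⟩) (by simp)
  obtain ⟨τ, hτ, h⟩ := Set.Nonempty.csInf_mem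
    (s := (fun σ : Fin n → Fin m => makespan p σ) '' {σ | Feasible k σ})
    ⟨_, σ, hσ, rfl⟩ (Set.toFinite _)
  exact ⟨τ, hτ, h⟩

lemma OPT_mono (hm : 0 < m) (hn : n ≤ m * k) {p s : Fin n → ℝ} (h : ∀ j, s j ≤ p j) :
    OPT m k s ≤ OPT m k p := by
  obtain ⟨τ, hτ, hp⟩ := exists_makespan_eq_OPT hm hn p
  rw [← hp]
  refine (OPT_le_makespan s hτ).trans (makespan_le hm fun i => ?_)
  exact (Finset.sum_le_sum fun j _ => h j).trans (machineLoad_le_makespan p τ i)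

lemma le_OPT (hm : 0 < m) (hn : n ≤ m * k) {p : Fin n → ℝ} (hp : ∀ j, 0 ≤ p j) (j : Fin n) :
    p j ≤ OPT m k p := by
  obtain ⟨τ, -, h⟩ := exists_makespan_eq_OPT hm hn p
  rw [← h]
  exact (le_machineLoad hp τ j).trans (machineLoad_le_makespan p τ _)

lemma OPT_nonneg {p : Fin n → ℝ} (hp : ∀ j, 0 ≤ p j) : 0 ≤ OPT m k p := by
  refine Real.sInf_nonneg ?_
  rintro _ ⟨σ, -, rfl⟩
  refine Real.sSup_nonneg ?_
  rintro _ ⟨i, rfl⟩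
  exact Finset.sum_nonneg fun j _ => hp j

lemma OPT_castSucc_le (hm : 0 < m) (hn : n + 1 ≤ m * k) {p : Fin (n + 1) → ℝ}
    (hp : ∀ j, 0 ≤ p j) : OPT m k (fun j : Fin n => p j.castSucc) ≤ OPT m k p := by
  obtain ⟨τ, hτ, h⟩ := exists_makespan_eq_OPT hm hn p
  rw [← h]
  have hsub : ∀ i, ({j : Fin n | τ j.castSucc = i} : Finset (Fin n)).map Fin.castSuccEmb ⊆
      Finset.univ.filter fun j => τ j = i := by
    intro i j hj
    obtain ⟨l, hl, rfl⟩ := Finset.mem_map.1 hj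
    exact Finset.mem_filter.2 ⟨Finset.mem_univ _, (Finset.mem_filter.1 hl).2⟩
  refine (OPT_le_makespan (σ := fun j => τ j.castSucc) _ fun i => ?_).trans
    (makespan_le hm fun i => ?_)
  · rw [← Finset.card_map Fin.castSuccEmb]
    exact (Finset.card_le_card (hsub i)).trans (hτ i)
  · refine le_trans ?_ (machineLoad_le_makespan p τ i)
    refine (Finset.sum_map {j : Fin n | τ j.castSucc = i} Fin.castSuccEmb p).symm.trans_le ?_
    exact Finset.sum_le_sum_of_subset_of_nonneg (hsub i) fun j _ _ => hp j

/-- A feasible schedule for which the jobs larger than `δ * OPT` contribute at most `OPT` to the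
load of each machine. -/
def LargeJobOptimal (m k : ℕ) (δ : ℝ) (s : Fin n → ℝ) (σ : Fin n → Fin m) : Prop :=
  Feasible k σ ∧
    ∀ i, ∑ j with σ j = i, (if δ * OPT m k s < s j then s j else 0) ≤ OPT m k s

lemma LargeJobOptimal.machineLoad_le {δ : ℝ} (hδ : 0 ≤ δ) {s : Fin n → ℝ} (hs : ∀ j, 0 ≤ s j)
    {σ : Fin n → Fin m} (h : LargeJobOptimal m k δ s σ) (i : Fin m) :
    machineLoad s σ i ≤ (1 + k * δ) * OPT m k s := by
  have hT : 0 ≤ δ * OPT m k s := mul_nonneg hδ (OPT_nonneg hs)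
  have hcard : (#{j | σ j = i} : ℝ) ≤ k := by exact_mod_cast h.1 i
  calc machineLoad s σ i
      ≤ ∑ j with σ j = i, ((if δ * OPT m k s < s j then s j else 0) + δ * OPT m k s) :=
        Finset.sum_le_sum fun j _ => by split_ifs <;> linarith
    _ = (∑ j with σ j = i, if δ * OPT m k s < s j then s j else 0) +
          #{j | σ j = i} * (δ * OPT m k s) := by
        rw [Finset.sum_add_distrib, Finset.sum_const, nsmul_eq_mul]
    _ ≤ OPT m k s + k * (δ * OPT m k s) :=
        add_le_add (h.2 i) (mul_le_mul_of_nonneg_right hcard hT)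
    _ = (1 + k * δ) * OPT m k s := by ring

end Makespan

/-- Rounding down to powers of `q`. -/
lemma exists_rounding {q : ℝ} (hq : 1 < q) : ∃ r : ℝ → ℝ, ∀ x, 0 ≤ x →
    0 ≤ r x ∧ r x ≤ x ∧ x ≤ q * r x ∧ (r x = 0 ∨ ∃ z : ℤ, r x = q ^ z) := by
  have h : ∀ x : ℝ, ∃ y : ℝ, 0 ≤ x → 0 ≤ y ∧ y ≤ x ∧ x ≤ q * y ∧ (y = 0 ∨ ∃ z : ℤ, y = q ^ z) := by
    intro x
    rcases le_or_gt x 0 with hx | hx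
    · exact ⟨0, fun h0 => ⟨le_rfl, h0, by simpa using hx, Or.inl rfl⟩⟩
    · obtain ⟨z, hz1, hz2⟩ := exists_mem_Ico_zpow hx hq
      have hq0 : 0 < q := by linarith
      refine ⟨q ^ z, fun _ => ⟨(zpow_pos hq0 z).le, hz1, ?_, Or.inr ⟨z, rfl⟩⟩⟩
      rw [zpow_add_one₀ hq0.ne', mul_comm] at hz2
      exact hz2.le
  choose r hr using h
  exact ⟨r, hr⟩

/-- The number of powers of `q` in an interval `(δ * T, T]` is bounded independently of `T`. -/
lemma exists_size_classes {q δ : ℝ} (hq : 1 < q) (hδ : 0 < δ) : ∃ d : ℕ, ∀ T : ℝ, 0 < T →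
    ∃ v : Fin d → ℝ, (∀ c, 0 ≤ v c) ∧
      ∀ z : ℤ, δ * T < q ^ z → q ^ z ≤ T → ∃ c, v c = q ^ z := by
  have hq0 : 0 < q := by linarith
  obtain ⟨d, hd⟩ := pow_unbounded_of_one_lt δ⁻¹ hq
  refine ⟨d, fun T hT => ?_⟩
  obtain ⟨y, hy1, hy2⟩ := exists_mem_Ico_zpow hT hq
  refine ⟨fun c => q ^ (y - (c : ℕ)), fun c => (zpow_pos hq0 _).le, fun z hz1 hz2 => ?_⟩
  have hzy : z < y + 1 := (zpow_lt_zpow_iff_right₀ hq).1 (hz2.trans_lt hy2)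
  have hyz : y < z + d := by
    refine (zpow_lt_zpow_iff_right₀ hq).1 (hy1.trans_lt ?_)
    rw [zpow_add₀ hq0.ne', zpow_natCast]
    calc T = δ * T * δ⁻¹ := by field_simp
      _ < q ^ z * q ^ d := mul_lt_mul'' hz1 hd (by positivity) (by positivity)
  refine ⟨⟨(y - z).toNat, by omega⟩, ?_⟩
  have hexp : y - ((y - z).toNat : ℤ) = z := by omega
  exact congrArg (q ^ ·) hexp

/-- The update step: after the arrival of a job, large-job optimality can be restored by touching
a set `W` of machines which is empty unless the new job is large. -/
lemma exists_update {q δ : ℝ} (hq : 1 < q) (hδ : 0 < δ) (k : ℕ) : ∃ K : ℕ, ∀ m n : ℕ, 0 < m →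
    n + 1 ≤ m * k → ∀ s : Fin (n + 1) → ℝ, (∀ j, 0 ≤ s j) →
    (∀ j, s j = 0 ∨ ∃ z : ℤ, s j = q ^ z) → ∀ σ : Fin n → Fin m,
    LargeJobOptimal m k δ (fun j => s j.castSucc) σ →
    ∃ (W : Finset (Fin m)) (σ' : Fin (n + 1) → Fin m), LargeJobOptimal m k δ s σ' ∧
      #W * (δ * OPT m k s) ≤ K * s (Fin.last n) ∧ ∀ j, σ j ∉ W → σ' j.castSucc = σ j := by
  classical
  obtain ⟨d, hd⟩ := exists_size_classes hq hδ
  obtain ⟨K, hK⟩ := exists_rearrangement d k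
  refine ⟨K, fun m n hm hn s hs hpow σ hσ => ?_⟩
  set T := OPT m k s with hT
  have hT0 : 0 ≤ T := OPT_nonneg hs
  have hTT : OPT m k (fun j : Fin n => s j.castSucc) ≤ T := OPT_castSucc_le hm hn hs
  have hold : ∀ i, ∑ j : Fin n with σ j = i,
      (if δ * T < s j.castSucc then s j.castSucc else 0) ≤ T := by
    refine fun i => le_trans (Finset.sum_le_sum fun j _ => ?_) ((hσ.2 i).trans hTT)
    have := mul_le_mul_of_nonneg_left hTT hδ.le
    have := hs j.castSucc
    split_ifs <;> linarith
  by_cases hlast : δ * T < s (Fin.last n)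
  · have hTpos : 0 < T :=
      ((mul_nonneg hδ.le hT0).trans_lt hlast).trans_le (le_OPT hm hn hs _)
    obtain ⟨v, hv0, hv⟩ := hd T hTpos
    have hty : ∀ j, ∃ t : Option (Fin d),
        (t.elim 0 v = if δ * T < s j then s j else 0) ∧ (δ * T < s j → t ≠ none) := by
      intro j
      split_ifs with hj
      · rcases hpow j with h0 | ⟨z, hz⟩
        · rw [h0] at hj
          exact absurd hj (mul_nonneg hδ.le hT0).not_gt
        · obtain ⟨c, hc⟩ := hv z (hz ▸ hj) (hz ▸ le_OPT hm hn hs j)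
          exact ⟨some c, hc.trans hz.symm, by simp⟩
      · exact ⟨none, rfl, fun h => absurd h hj⟩
    choose ty hty1 hty2 using hty
    obtain ⟨τ, hτ, hτT⟩ := exists_makespan_eq_OPT hm hn s
    obtain ⟨W, σ', hW, hσ', hkeep, hload⟩ := hK m n hn ty σ τ hσ.1 hτ (hty2 _ hlast)
    refine ⟨W, σ', ⟨hσ', fun i => ?_⟩, ?_, hkeep⟩
    · have hi := hload (fun t => t.elim 0 v) rfl
        (fun t => by cases t with
          | none => exact le_rfl
          | some c => exact hv0 c) i
      simp only [hty1] at hi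
      rcases hi with hi | ⟨i', hi⟩
      · exact hi.trans (hold i)
      · refine hi.trans (le_trans (Finset.sum_le_sum fun j _ => ?_)
          ((machineLoad_le_makespan s τ i').trans_eq hτT))
        have := hs j
        split_ifs <;> linarith
    · exact mul_le_mul (by exact_mod_cast hW) hlast.le (mul_nonneg hδ.le hT0) (by positivity)
  · obtain ⟨σ', hσ', hkeep⟩ := exists_feasible_extension hn
      (Finset.univ.map Fin.castSuccEmb) (Fin.lastCases ⟨0, hm⟩ σ) (fun i => by
        rw [Finset.filter_map, Finset.card_map]
        simpa [Function.comp_def] using hσ.1 i)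
    have hkeep' : ∀ j : Fin n, σ' j.castSucc = σ j := fun j =>
      (hkeep _ (Finset.mem_map.2 ⟨j, Finset.mem_univ _, rfl⟩)).trans (Fin.lastCases_castSucc ..)
    refine ⟨∅, σ', ⟨hσ', fun i => ?_⟩, ?_, fun j _ => hkeep' j⟩
    · rw [Finset.sum_filter, Fin.sum_univ_castSucc, if_neg hlast, ite_self, add_zero]
      simp only [hkeep']
      rw [← Finset.sum_filter]
      exact hold i
    · simpa using mul_nonneg (Nat.cast_nonneg K) (hs (Fin.last n))

/-- The robust algorithm that repeatedly chooses an updated schedule with property `P`. -/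
noncomputable def iterateUpdate {m : ℕ} (i₀ : Fin m)
    (P : ∀ t : ℕ, (Fin (t + 1) → ℝ) → (Fin t → Fin m) → (Fin (t + 1) → Fin m) → Prop) :
    RobustAlg m
  | 0, _ => Fin.elim0
  | t + 1, p =>
    open Classical in
    if h : ∃ σ', P t p (iterateUpdate i₀ P t fun j => p j.castSucc) σ' then h.choose
    else fun _ => i₀

lemma iterateUpdate_spec {m : ℕ} (i₀ : Fin m)
    (P : ∀ t : ℕ, (Fin (t + 1) → ℝ) → (Fin t → Fin m) → (Fin (t + 1) → Fin m) → Prop)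
    (p : ℕ → ℝ) (t : ℕ)
    (h : ∃ σ', P t (prefixSeq p (t + 1)) (iterateUpdate i₀ P t (prefixSeq p t)) σ') :
    P t (prefixSeq p (t + 1)) (iterateUpdate i₀ P t (prefixSeq p t))
      (iterateUpdate i₀ P (t + 1) (prefixSeq p (t + 1))) := by
  have heq : iterateUpdate i₀ P (t + 1) (prefixSeq p (t + 1)) = h.choose := by
    rw [iterateUpdate]
    exact dif_pos h
  rw [heq]
  exact h.choose_spec

/-- For every `ε > 0` and every positive integer `k` there is a real `β = β(ε, k)` such
that for every positive number of machines `m` there is a robust algorithm on `m` machines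
with cardinality bound `k`, migration factor at most `β`, that is `(1+ε)`-competitive
(robust EPTAS for constant `k`). -/
theorem robust_eptas_constant_k :
    ∀ ε : ℝ, 0 < ε → ∀ k : ℕ, 0 < k →
      ∃ β : ℝ, ∀ m : ℕ, 0 < m →
        ∃ R : RobustAlg m,
          IsRobust m k β R ∧ RobustCompetitive m k R (1 + ε) := by
  intro ε hε k hk
  obtain ⟨η, hη, hηε⟩ : ∃ η : ℝ, 0 < η ∧ (1 + η) * (1 + η) ≤ 1 + ε := by
    refine ⟨min 1 (ε / 3), by positivity, ?_⟩
    have h1 := min_le_left 1 (ε / 3)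
    have h2 := min_le_right 1 (ε / 3)
    have h3 : 0 < min 1 (ε / 3) := by positivity
    nlinarith
  have hk' : (0 : ℝ) < k := by exact_mod_cast hk
  let q : ℝ := 1 + η
  let δ : ℝ := η / k
  have hq : 1 < q := by simp only [q]; linarith
  have hδ : 0 < δ := by positivity
  have hkδ : 1 + k * δ = q := by simp only [q, δ]; field_simp
  obtain ⟨r, hr⟩ := exists_rounding hq
  obtain ⟨K, hK⟩ := exists_update hq hδ k
  refine ⟨q * q / δ * K, fun m hm => ?_⟩
  let P : ∀ t : ℕ, (Fin (t + 1) → ℝ) → (Fin t → Fin m) → (Fin (t + 1) → Fin m) → Prop :=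
    fun t p σ σ' => LargeJobOptimal m k δ (fun j => r (p j)) σ' ∧ ∃ W : Finset (Fin m),
      #W * (δ * OPT m k fun j => r (p j)) ≤ K * r (p (Fin.last t)) ∧
        ∀ j, σ j ∉ W → σ' j.castSucc = σ j
  let R : RobustAlg m := iterateUpdate ⟨0, hm⟩ P
  have hstep : ∀ p : ℕ → ℝ, (∀ j, 0 ≤ p j) → ∀ t, t + 1 ≤ m * k →
      LargeJobOptimal m k δ (fun j => r (prefixSeq p t j)) (R t (prefixSeq p t)) →
      P t (prefixSeq p (t + 1)) (R t (prefixSeq p t)) (R (t + 1) (prefixSeq p (t + 1))) := by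
    intro p hp t ht hopt
    refine iterateUpdate_spec _ P p t ?_
    obtain ⟨W, σ', h1, h2, h3⟩ := hK m t hm ht (fun j => r (prefixSeq p (t + 1) j))
      (fun j => (hr _ (hp _)).1) (fun j => (hr _ (hp _)).2.2.2) (R t (prefixSeq p t)) hopt
    exact ⟨σ', h1, W, h2, h3⟩
  have hinv : ∀ p : ℕ → ℝ, (∀ j, 0 ≤ p j) → ∀ t, t ≤ m * k →
      LargeJobOptimal m k δ (fun j => r (prefixSeq p t j)) (R t (prefixSeq p t)) := by
    intro p hp t
    induction t with
    | zero =>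
      exact fun _ => ⟨fun i => by simp, fun i => by simpa using OPT_nonneg fun j => j.elim0⟩
    | succ t ih => exact fun ht => (hstep p hp t ht (ih (by omega))).1
  have hload : ∀ p : ℕ → ℝ, (∀ j, 0 ≤ p j) → ∀ t, t ≤ m * k → ∀ i,
      machineLoad (prefixSeq p t) (R t (prefixSeq p t)) i ≤
        q * q * OPT m k fun j => r (prefixSeq p t j) := by
    intro p hp t ht i
    have h := (hinv p hp t ht).machineLoad_le hδ.le (fun j => (hr _ (hp _)).1) i
    rw [hkδ] at h
    calc machineLoad (prefixSeq p t) (R t (prefixSeq p t)) i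
        ≤ ∑ j with R t (prefixSeq p t) j = i, q * r (prefixSeq p t j) :=
          Finset.sum_le_sum fun j _ => (hr _ (hp _)).2.2.1
      _ = q * machineLoad (fun j => r (prefixSeq p t j)) (R t (prefixSeq p t)) i :=
          (Finset.mul_sum ..).symm
      _ ≤ q * (q * OPT m k fun j => r (prefixSeq p t j)) :=
          mul_le_mul_of_nonneg_left h (by linarith)
      _ = _ := by ring
  refine ⟨R, fun p hp => ⟨fun t ht => (hinv p hp t ht).1, fun t ht => ?_⟩, fun p hp t ht => ?_⟩
  · obtain ⟨-, W, hW, hkeep⟩ := hstep p hp t ht (hinv p hp t (by omega))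
    have hmono : (OPT m k fun j => r (prefixSeq p t j)) ≤
        OPT m k fun j => r (prefixSeq p (t + 1) j) :=
      OPT_castSucc_le hm ht (p := fun j => r (prefixSeq p (t + 1) j)) fun j => (hr _ (hp _)).1
    set T := OPT m k fun j => r (prefixSeq p (t + 1) j)
    calc ∑ j : Fin t with R (t + 1) (prefixSeq p (t + 1)) j.castSucc ≠ R t (prefixSeq p t) j, p j.1
        ≤ ∑ j : Fin t with R t (prefixSeq p t) j ∈ W, p j.1 := by
          refine Finset.sum_le_sum_of_subset_of_nonneg ?_ fun j _ _ => hp _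
          exact Finset.monotone_filter_right _ fun j _ h => by_contra fun h' => h (hkeep j h')
      _ = ∑ i ∈ W, machineLoad (prefixSeq p t) (R t (prefixSeq p t)) i := by
          rw [← Finset.sum_fiberwise_of_maps_to (t := W) (g := R t (prefixSeq p t))
            fun j hj => (Finset.mem_filter.1 hj).2]
          refine Finset.sum_congr rfl fun i hi => Finset.sum_congr ?_ fun _ _ => rfl
          ext j
          simp only [Finset.mem_filter, Finset.mem_univ, true_and]
          exact ⟨And.right, fun h => ⟨h ▸ hi, h⟩⟩
      _ ≤ ∑ _i ∈ W, q * q * T := Finset.sum_le_sum fun i _ =>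
          (hload p hp t (by omega) i).trans (mul_le_mul_of_nonneg_left hmono (by positivity))
      _ = q * q / δ * (#W * (δ * T)) := by
          rw [Finset.sum_const, nsmul_eq_mul]
          field_simp
      _ ≤ q * q / δ * (K * r (p t)) := mul_le_mul_of_nonneg_left hW (by positivity)
      _ ≤ q * q / δ * (K * p t) := by
          have := (hr _ (hp t)).2.1
          gcongr
      _ = q * q / δ * K * p t := by ring
  · have hmono : (OPT m k fun j => r (prefixSeq p t j)) ≤ OPT m k (prefixSeq p t) :=
      OPT_mono hm ht fun j => (hr _ (hp _)).2.1
    have hnonneg : 0 ≤ OPT m k (prefixSeq p t) := OPT_nonneg fun j => hp _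
    refine makespan_le hm fun i => (hload p hp t ht i).trans ?_
    exact (mul_le_mul_of_nonneg_left hmono (by positivity)).trans
      (mul_le_mul_of_nonneg_right hηε hnonneg)
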